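/- arXiv:math/0511698 — 2 statements merged into one kernel-verified Lean document; each statement's English description precedes it below -/
import Mathlib

section
/- Let n,m ≥ 1, 1 ≤ i ≤ n, σ ∈ S_n and τ ∈ S_m. Then in the free ℤ-module ℤS_{n+m−1} one has M_σ ∘_i M_τ = Σ_{ρ : B_i(σ,τ) ≤ ρ ≤ T_i(σ,τ)} M_ρ, where the sum runs over all permutations ρ ∈ S_{n+m−1} lying in the interval [B_i(σ,τ), T_i(σ,τ)] of the left weak order. -/
open Equiv

/-- The one-line value (0-indexed) of a permutation of `Fin N`, extended to all of `ℕ`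
by the identity.  Position `j` (0-indexed) carries the value `pv σ j` (0-indexed). -/
def pv {N : ℕ} (σ : Equiv.Perm (Fin N)) (j : ℕ) : ℕ :=
  if h : j < N then (σ ⟨j, h⟩ : ℕ) else j

/-- The left weak (Bruhat) order on `S_N`: inclusion of inversion sets, where the
inversion set of `σ` is `{(p,q) | p < q ∧ σ p > σ q}`. -/
def wle {N : ℕ} (σ τ : Equiv.Perm (Fin N)) : Prop :=
  ∀ p q : Fin N, p < q → σ q < σ p → τ q < τ p

instance {N : ℕ} (σ τ : Equiv.Perm (Fin N)) : Decidable (wle σ τ) :=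
  inferInstanceAs (Decidable (∀ p q : Fin N, p < q → σ q < σ p → τ q < τ p))

/-- The `a`-values of the insertion construction `B_i` (0-indexed values):
`avv m s x = x` if `x < s` and `x + m - 1` otherwise. -/
def avv (m s x : ℕ) : ℕ := if x < s then x else x + m - 1

/-- The one-line values of the permutation `B_i(σ,τ) ∈ S_{n+m-1}`
(0-indexed position `i`, with `i < n`, and 0-indexed values). -/
def BFun {n m : ℕ} (i : ℕ) (σ : Equiv.Perm (Fin n)) (τ : Equiv.Perm (Fin m)) (j : ℕ) : ℕ :=
  if j < i then avv m (pv σ i) (pv σ j)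
  else if j < i + m then pv τ (j - i) + pv σ i
  else avv m (pv σ i) (pv σ (j - m + 1))

/-- `ρ ∈ S_{n+m-1}` is the permutation `B_i(σ,τ)`. -/
def IsB {n m : ℕ} (i : ℕ) (σ : Equiv.Perm (Fin n)) (τ : Equiv.Perm (Fin m))
    (ρ : Equiv.Perm (Fin (n + m - 1))) : Prop :=
  ∀ j : ℕ, j < n + m - 1 → pv ρ j = BFun i σ τ j

/-- The set of entries of the first block `L₁` of `B_i(σ,τ)` (positions `< i`, 0-indexed). -/
def bL1 {n m : ℕ} (i : ℕ) (σ : Equiv.Perm (Fin n)) (τ : Equiv.Perm (Fin m)) : Set ℕ :=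
  BFun i σ τ '' {p | p < i}

/-- The set of entries of the third block `L₃` of `B_i(σ,τ)`
(positions in `[i+m, n+m-2]`, 0-indexed). -/
def bL3 {n m : ℕ} (i : ℕ) (σ : Equiv.Perm (Fin n)) (τ : Equiv.Perm (Fin m)) : Set ℕ :=
  BFun i σ τ '' {p | i + m ≤ p ∧ p < n + m - 1}

/-- The number `k_σ`: the largest `j ≤ i` such that the interval `[σ_i - j, σ_i]`
(of actual integers, whence also `j ≤ σ_i`) is contained in `{L₁} ∪ {σ_i}`. -/
noncomputable def kpar {n m : ℕ} (i : ℕ) (σ : Equiv.Perm (Fin n)) (τ : Equiv.Perm (Fin m)) : ℕ :=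
  sSup {j | j ≤ i ∧ j ≤ pv σ i ∧
    Set.Icc (pv σ i - j) (pv σ i) ⊆ insert (pv σ i) (bL1 i σ τ)}

/-- The number `l_σ`: the largest `j ≤ n - 1 - i` such that `[η, η + j] ⊆ {η} ∪ {L₃}`,
where `η = σ_i + m - 1`. -/
noncomputable def lpar {n m : ℕ} (i : ℕ) (σ : Equiv.Perm (Fin n)) (τ : Equiv.Perm (Fin m)) : ℕ :=
  sSup {j | j ≤ n - 1 - i ∧
    Set.Icc (pv σ i + m - 1) (pv σ i + m - 1 + j) ⊆ insert (pv σ i + m - 1) (bL3 i σ τ)}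

/-- `A_{1,b}`: the entries of `L₁` smaller than `σ_i - k_σ`. -/
noncomputable def A1b {n m : ℕ} (i : ℕ) (σ : Equiv.Perm (Fin n)) (τ : Equiv.Perm (Fin m)) :
    Set ℕ := {x ∈ bL1 i σ τ | x < pv σ i - kpar i σ τ}

/-- `A_{1,t}`: the entries of `L₁` bigger than `σ_i`. -/
def A1t {n m : ℕ} (i : ℕ) (σ : Equiv.Perm (Fin n)) (τ : Equiv.Perm (Fin m)) : Set ℕ :=
  {x ∈ bL1 i σ τ | pv σ i < x}

/-- `A_{3,b}`: the entries of `L₃` smaller than `η = σ_i + m - 1`. -/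
def A3b {n m : ℕ} (i : ℕ) (σ : Equiv.Perm (Fin n)) (τ : Equiv.Perm (Fin m)) : Set ℕ :=
  {x ∈ bL3 i σ τ | x < pv σ i + m - 1}

/-- `A_{3,t}`: the entries of `L₃` bigger than `η + l_σ`. -/
noncomputable def A3t {n m : ℕ} (i : ℕ) (σ : Equiv.Perm (Fin n)) (τ : Equiv.Perm (Fin m)) :
    Set ℕ := {x ∈ bL3 i σ τ | pv σ i + m - 1 + lpar i σ τ < x}

/-- `ρ ∈ S_{n+m-1}` is the permutation `T_i(σ,τ)`:  for `m = 1` it is `σ` itself;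
for `m ≥ 2` its three blocks standardize like those of `B_i(σ,τ)` and have the
prescribed entry sets. -/
noncomputable def IsT {n m : ℕ} (i : ℕ) (σ : Equiv.Perm (Fin n)) (τ : Equiv.Perm (Fin m))
    (ρ : Equiv.Perm (Fin (n + m - 1))) : Prop :=
  if m = 1 then (∀ p : ℕ, pv ρ p = pv σ p)
  else
    (∀ p q : ℕ, p < i → q < i → (pv ρ p < pv ρ q ↔ BFun i σ τ p < BFun i σ τ q)) ∧
    (∀ p q : ℕ, i ≤ p → p < i + m → i ≤ q → q < i + m →
      (pv ρ p < pv ρ q ↔ BFun i σ τ p < BFun i σ τ q)) ∧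
    (∀ p q : ℕ, i + m ≤ p → p < n + m - 1 → i + m ≤ q → q < n + m - 1 →
      (pv ρ p < pv ρ q ↔ BFun i σ τ p < BFun i σ τ q)) ∧
    pv ρ '' {p | p < i} =
      A1b i σ τ ∪
        Set.Ico (pv σ i + m - 1 + lpar i σ τ - kpar i σ τ) (pv σ i + m - 1 + lpar i σ τ) ∪
        A1t i σ τ ∧
    pv ρ '' {p | i ≤ p ∧ p < i + m} =
      insert (pv σ i - kpar i σ τ) (insert (pv σ i + m - 1 + lpar i σ τ)
        (Set.Ioo (pv σ i - kpar i σ τ + lpar i σ τ)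
          (pv σ i + m - 1 + lpar i σ τ - kpar i σ τ))) ∧
    pv ρ '' {p | i + m ≤ p ∧ p < n + m - 1} =
      A3b i σ τ ∪ Set.Ioc (pv σ i - kpar i σ τ) (pv σ i - kpar i σ τ + lpar i σ τ) ∪
        A3t i σ τ

/-- The monomial basis element `M_σ = Σ_{σ ≤ τ} μ(σ,τ) F_τ` of the free `ℤ`-module
`ℤS_N = Perm (Fin N) →₀ ℤ`, for a given Möbius function `mu` of the weak order;
here `F_τ = Finsupp.single τ 1`. -/
noncomputable def Msig {N : ℕ} (mu : Equiv.Perm (Fin N) → Equiv.Perm (Fin N) → ℤ)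
    (σ : Equiv.Perm (Fin N)) : Equiv.Perm (Fin N) →₀ ℤ :=
  ∑ τ ∈ Finset.univ.filter (fun τ => wle σ τ), mu σ τ • Finsupp.single τ (1 : ℤ)

/-- The statement that `mu` is the Möbius function of the left weak order in each degree:
`Σ_{σ ≤ ρ ≤ τ} μ(σ,ρ)` equals `1` if `σ = τ` and `0` if `σ < τ`. -/
def IsMoebius (mu : ∀ N : ℕ, Equiv.Perm (Fin N) → Equiv.Perm (Fin N) → ℤ) : Prop :=
  ∀ (N : ℕ) (σ τ : Equiv.Perm (Fin N)), wle σ τ →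
    (∑ ρ ∈ Finset.univ.filter (fun ρ => wle σ ρ ∧ wle ρ τ), mu N σ ρ)
      = if σ = τ then 1 else 0

/-- The bilinear operadic composition `∘_i : ℤS_n × ℤS_m → ℤS_{n+m-1}` determined on the
`F`-basis by `F_σ ∘_i F_τ = F_{B_i(σ,τ)}`, given the map `Bp = B_i` on permutations. -/
noncomputable def circF {n m : ℕ}
    (Bp : Equiv.Perm (Fin n) → Equiv.Perm (Fin m) → Equiv.Perm (Fin (n + m - 1)))
    (x : Equiv.Perm (Fin n) →₀ ℤ) (y : Equiv.Perm (Fin m) →₀ ℤ) :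
    Equiv.Perm (Fin (n + m - 1)) →₀ ℤ :=
  x.sum fun σ c => y.sum fun τ d => (c * d) • Finsupp.single (Bp σ τ) (1 : ℤ)

section OneLine

variable {N : ℕ}

theorem pv_lt (σ : Perm (Fin N)) {p : ℕ} (hp : p < N) : pv σ p < N := by
  simp [pv, hp]

theorem pv_inj (σ : Perm (Fin N)) {p q : ℕ} (hp : p < N) (hq : q < N)
    (h : pv σ p = pv σ q) : p = q := by
  simp only [pv, hp, hq, dif_pos] at h
  simpa using σ.injective (Fin.ext h)

theorem exists_pv_eq (σ : Perm (Fin N)) {x : ℕ} (hx : x < N) : ∃ p < N, pv σ p = x :=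
  ⟨σ.symm ⟨x, hx⟩, (σ.symm ⟨x, hx⟩).isLt, by simp [pv]⟩

theorem wle_iff {σ τ : Perm (Fin N)} :
    wle σ τ ↔ ∀ p q : ℕ, p < q → q < N → pv σ q < pv σ p → pv τ q < pv τ p := by
  constructor
  · intro h p q hpq hq
    have hp : p < N := hpq.trans hq
    simpa [pv, hp, hq] using h ⟨p, hp⟩ ⟨q, hq⟩ hpq
  · intro h p q hpq
    simpa [pv] using h p q hpq q.isLt

theorem wle_refl (σ : Perm (Fin N)) : wle σ σ := fun _ _ _ h => h

theorem wle_trans {σ τ ρ : Perm (Fin N)} (h₁ : wle σ τ) (h₂ : wle τ ρ) : wle σ ρ :=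
  fun p q hpq h => h₂ p q hpq (h₁ p q hpq h)

/-- Two functions which order a set in the same way and have the same image agree. -/
theorem eq_of_lt_iff_of_image_eq {α : Type*} {S : Set α} {f g : α → ℕ}
    (hlt : ∀ p ∈ S, ∀ q ∈ S, (f p < f q ↔ g p < g q)) (him : f '' S = g '' S) :
    ∀ p ∈ S, f p = g p := by
  suffices ∀ v, ∀ p ∈ S, f p = v → g p = v from fun p hp => (this _ p hp rfl).symm
  intro v
  induction v using Nat.strong_induction_on with
  | _ v ih =>
    intro p hp hv
    obtain ⟨q, hq, hqp⟩ : g p ∈ f '' S := him ▸ ⟨p, hp, rfl⟩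
    obtain ⟨r, hr, hrp⟩ : f p ∈ g '' S := him ▸ ⟨p, hp, rfl⟩
    have h₁ := hlt q hq p hp
    have h₂ := hlt r hr p hp
    rcases lt_trichotomy (f q) (f p) with h | h | h
    · have := ih (f q) (hv ▸ h) q hq rfl
      omega
    · omega
    · have h₃ : f r < f p := h₂.2 (by omega)
      have := ih (f r) (hv ▸ h₃) r hr rfl
      omega

theorem wle_antisymm {σ τ : Perm (Fin N)} (h₁ : wle σ τ) (h₂ : wle τ σ) : σ = τ := by
  have key := eq_of_lt_iff_of_image_eq (S := Set.univ) (f := fun p => (σ p : ℕ))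
    (g := fun p => (τ p : ℕ)) ?_ ?_
  · ext p
    exact key p trivial
  · intro p _ q _
    simp only [Fin.val_fin_lt]
    rcases lt_trichotomy p q with h | rfl | h
    · have h3 : σ p ≠ σ q := fun e => h.ne (σ.injective e)
      have h4 : τ p ≠ τ q := fun e => h.ne (τ.injective e)
      have h5 := h₁ p q h
      have h6 := h₂ p q h
      constructor <;> intro h7 <;> by_contra h8
      · exact absurd (h6 (lt_of_le_of_ne (not_lt.1 h8) h4.symm)) h7.asymm
      · exact absurd (h5 (lt_of_le_of_ne (not_lt.1 h8) h3.symm)) h7.asymm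
    · simp
    · exact ⟨h₁ q p h, h₂ q p h⟩
  · ext x
    simp only [Set.image_univ, Set.mem_range]
    constructor
    · rintro ⟨p, rfl⟩
      exact ⟨τ.symm (σ p), by simp⟩
    · rintro ⟨p, rfl⟩
      exact ⟨σ.symm (τ p), by simp⟩

theorem exists_perm_lt_iff (f : ℕ → ℕ) (hf : ∀ p q, p < N → q < N → f p = f q → p = q) :
    ∃ σ : Perm (Fin N), ∀ p q, p < N → q < N → (pv σ p < pv σ q ↔ f p < f q) := by
  let g : Fin N → ℕ := fun p => f p
  have hg : StrictMono (g ∘ Tuple.sort g) :=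
    (Tuple.monotone_sort g).strictMono_of_injective
      (Function.Injective.comp (fun p q h => Fin.ext (hf p q p.isLt q.isLt h))
        (Tuple.sort g).injective)
  refine ⟨(Tuple.sort g).symm, fun p q hp hq => ?_⟩
  have := hg.lt_iff_lt (a := (Tuple.sort g).symm ⟨p, hp⟩) (b := (Tuple.sort g).symm ⟨q, hq⟩)
  simp only [Function.comp, apply_symm_apply] at this
  simp only [pv, hp, hq, dif_pos, Fin.val_fin_lt]
  exact this.symm

end OneLine

section Adjoint

variable {n m i a b : ℕ}

/-- `a` and `b` are the extreme values of `v` on the positions `[i, i + m)`. -/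
structure IsBlockBounds (v : ℕ → ℕ) (i m a b : ℕ) : Prop where
  exists_min : ∃ p < m, v (i + p) = a
  exists_max : ∃ p < m, v (i + p) = b
  le : ∀ p < m, a ≤ v (i + p) ∧ v (i + p) ≤ b

theorem exists_isBlockBounds (v : ℕ → ℕ) (i : ℕ) (hm : 1 ≤ m) :
    ∃ a b, IsBlockBounds v i m a b := by
  have hne : (Finset.range m).Nonempty := ⟨0, by simp; omega⟩
  obtain ⟨p, hp, hpmin⟩ := Finset.exists_min_image (Finset.range m) (fun p => v (i + p)) hne
  obtain ⟨q, hq, hqmax⟩ := Finset.exists_max_image (Finset.range m) (fun p => v (i + p)) hne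
  simp only [Finset.mem_range] at *
  exact ⟨_, _, ⟨p, hp, rfl⟩, ⟨q, hq, rfl⟩, fun r hr => ⟨hpmin r hr, hqmax r hr⟩⟩

/-- The inversions `(p, q)` obtained from the one-line values `v` by contracting the block of
positions `[i, i + m)`, with extreme values `a` and `b`, to a single position `i`. -/
def contractInv (i m a b : ℕ) (v : ℕ → ℕ) (p q : ℕ) : Prop :=
  if q < i then v q < v p
  else if q = i then b < v p
  else if p < i then v (q + m - 1) < v p ∧ (b < v p ∨ v (q + m - 1) < a)
  else if p = i then v (q + m - 1) < a
  else v (q + m - 1) < v (p + m - 1)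

/-- Insertion of a position between those left of the block and those right of it. -/
theorem exists_perm_contract {N : ℕ} (w : ℕ → ℕ) (hab : a ≤ b)
    (hw : ∀ p < n, p ≠ i → w p < N ∧ w p ≠ a ∧ w p ≠ b)
    (hinj : ∀ p < n, ∀ q < n, p ≠ i → q ≠ i → w p = w q → p = q) :
    ∃ σ : Perm (Fin n), ∀ p q, p < q → q < n → (pv σ q < pv σ p ↔
      if q < i then w q < w p
      else if q = i then b < w p
      else if p < i then w q < w p ∧ (b < w p ∨ w q < a)
      else if p = i then w q < a
      else w q < w p) := by
  let f : ℕ → ℕ := fun p =>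
    if p = i then 2 * N
    else if w p < a then w p
    else if b < w p then 4 * N + w p
    else if p < i then N + w p
    else 3 * N + w p
  have hf : ∀ p q, p < n → q < n → f p = f q → p = q := by
    intro p q hp hq h
    have h1 := hw p hp
    have h2 := hw q hq
    have h3 := hinj p hp q hq
    simp only [f] at h
    by_cases hpi : p = i <;> by_cases hqi : q = i
    · omega
    · have := h2 hqi
      simp only [hpi, hqi, if_true, if_false] at h
      split_ifs at h <;> omega
    · have := h1 hpi
      simp only [hpi, hqi, if_true, if_false] at h
      split_ifs at h <;> omega
    · refine h3 hpi hqi ?_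
      have := h1 hpi
      have := h2 hqi
      simp only [hpi, hqi, if_false] at h
      split_ifs at h <;> omega
  obtain ⟨σ, hσ⟩ := exists_perm_lt_iff f hf
  refine ⟨σ, fun p q hpq hq => ?_⟩
  rw [hσ q p hq (hpq.trans hq)]
  have h1 := hw p (hpq.trans hq)
  have h2 := hw q hq
  simp only [f]
  rcases lt_trichotomy p i with hp | hp | hp <;> rcases lt_trichotomy q i with hqi | hqi | hqi <;>
    try omega
  · have := h1 hp.ne
    have := h2 hqi.ne
    simp only [hp, hqi, hp.ne, hqi.ne, if_true, if_false]
    split_ifs <;> omega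
  · have := h1 hp.ne
    simp only [hp, hqi, hp.ne, lt_irrefl, if_true, if_false]
    split_ifs <;> omega
  · have := h1 hp.ne
    have := h2 hqi.ne'
    simp only [hp, hqi.not_gt, hp.ne, hqi.ne', if_true, if_false]
    split_ifs <;> omega
  · have := h2 hqi.ne'
    simp only [hp, hqi.not_gt, hqi.ne', lt_irrefl, if_true, if_false]
    split_ifs <;> omega
  · have := h1 hp.ne'
    have := h2 hqi.ne'
    simp only [hp.not_gt, hqi.not_gt, hp.ne', hqi.ne', if_false]
    split_ifs <;> omega

theorem exists_contract (hm : 1 ≤ m) (hi : i < n) (ρ : Perm (Fin (n + m - 1)))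
    (hab : IsBlockBounds (pv ρ) i m a b) :
    ∃ σ : Perm (Fin n), ∀ p q, p < q → q < n →
      (pv σ q < pv σ p ↔ contractInv i m a b (pv ρ) p q) := by
  obtain ⟨x, hx, hxa⟩ := hab.exists_min
  obtain ⟨y, hy, hyb⟩ := hab.exists_max
  let e : ℕ → ℕ := fun p => if p < i then p else p + m - 1
  have he₁ : ∀ p, p < i → e p = p := fun p hp => if_pos hp
  have he₂ : ∀ p, ¬ p < i → e p = p + m - 1 := fun p hp => if_neg hp
  have he : ∀ p < n, p ≠ i → e p < n + m - 1 ∧ (e p < i ∨ i + m ≤ e p) := by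
    intro p hp hpi
    by_cases h : p < i
    · rw [he₁ p h]
      omega
    · rw [he₂ p h]
      omega
  obtain ⟨σ, hσ⟩ := exists_perm_contract (n := n) (i := i) (N := n + m - 1)
    (fun p => pv ρ (e p)) ((hab.le x hx).1.trans (hab.le x hx).2) (fun p hp hpi => by
      have := he p hp hpi
      refine ⟨pv_lt ρ this.1, fun h => ?_, fun h => ?_⟩
      · have := pv_inj ρ this.1 (by omega) (h.trans hxa.symm)
        omega
      · have := pv_inj ρ this.1 (by omega) (h.trans hyb.symm)
        omega)
    (fun p hp q hq hpi hqi h => by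
      have h1 := he p hp hpi
      have h2 := he q hq hqi
      have h3 := pv_inj ρ h1.1 h2.1 h
      simp only [e] at h3
      split_ifs at h3 <;> omega)
  refine ⟨σ, fun p q hpq hq => ?_⟩
  rw [hσ p q hpq hq, contractInv]
  split_ifs with h1 h2 h3 h4
  · rw [he₁ q h1, he₁ p (hpq.trans h1)]
  · rw [he₁ p (h2 ▸ hpq)]
  · rw [he₁ p h3, he₂ q h1]
  · rw [he₂ q h1]
  · rw [he₂ q h1, he₂ p h3]

/-- `(σ, τ)` is the value at `ρ` of the right adjoint of `B_i`. -/
structure IsAdjoint (i a b : ℕ) (ρ : Perm (Fin (n + m - 1))) (σ : Perm (Fin n))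
    (τ : Perm (Fin m)) : Prop where
  bounds : IsBlockBounds (pv ρ) i m a b
  outer : ∀ p q, p < q → q < n → (pv σ q < pv σ p ↔ contractInv i m a b (pv ρ) p q)
  block : ∀ p q, p < m → q < m → (pv τ p < pv τ q ↔ pv ρ (i + p) < pv ρ (i + q))

theorem exists_isAdjoint (hm : 1 ≤ m) (hi : i < n) (ρ : Perm (Fin (n + m - 1))) :
    ∃ a b, ∃ (σ : Perm (Fin n)) (τ : Perm (Fin m)), IsAdjoint i a b ρ σ τ := by
  obtain ⟨a, b, hab⟩ := exists_isBlockBounds (pv ρ) i hm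
  obtain ⟨σ, hσ⟩ := exists_contract hm hi ρ hab
  obtain ⟨τ, hτ⟩ := exists_perm_lt_iff (N := m) (fun p => pv ρ (i + p)) (fun p q hp hq h => by
    have := pv_inj ρ (by omega) (by omega) h
    omega)
  exact ⟨a, b, σ, τ, hab, hσ, hτ⟩

variable {σ σ' : Perm (Fin n)} {τ τ' : Perm (Fin m)} {ρ β : Perm (Fin (n + m - 1))}

theorem avv_lt_avv_iff (hm : 1 ≤ m) {s x y : ℕ} : avv m s x < avv m s y ↔ x < y := by
  unfold avv
  split_ifs <;> omega

theorem add_lt_avv_iff {t s x : ℕ} (ht : t < m) (hx : x ≠ s) : t + s < avv m s x ↔ s < x := by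
  unfold avv
  split_ifs <;> omega

theorem avv_lt_add_iff {t s x : ℕ} (ht : t < m) : avv m s x < t + s ↔ x < s := by
  unfold avv
  split_ifs <;> omega

theorem BFun_left {p : ℕ} (hp : p < i) : BFun i σ τ p = avv m (pv σ i) (pv σ p) :=
  if_pos hp

theorem BFun_block {p : ℕ} (hp : p < m) : BFun i σ τ (i + p) = pv τ p + pv σ i := by
  rw [BFun, if_neg (by omega), if_pos (by omega), Nat.add_sub_cancel_left]

theorem BFun_right (hm : 1 ≤ m) {p : ℕ} (hp : i < p) :
    BFun i σ τ (p + m - 1) = avv m (pv σ i) (pv σ p) := by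
  rw [BFun, if_neg (by omega), if_neg (by omega), show p + m - 1 - m + 1 = p by omega]

/-- Every position is left of the block, in the block, or right of it. -/
theorem position_cases (hm : 1 ≤ m) (i : ℕ) {p : ℕ} (hp : p < n + m - 1) :
    p < i ∨ (∃ j < m, p = i + j) ∨ ∃ q, i < q ∧ q < n ∧ p = q + m - 1 := by
  by_cases h1 : p < i
  · exact .inl h1
  by_cases h2 : p < i + m
  · exact .inr (.inl ⟨p - i, by omega, by omega⟩)
  · exact .inr (.inr ⟨p + 1 - m, by omega, by omega, by omega⟩)

theorem wle_iff_of_isAdjoint (hm : 1 ≤ m) (hi : i < n) (hB : IsB i σ' τ' β)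
    (hadj : IsAdjoint i a b ρ σ τ) : wle β ρ ↔ wle σ' σ ∧ wle τ' τ := by
  have hl : ∀ {p}, p < i → pv β p = avv m (pv σ' i) (pv σ' p) :=
    fun {p} hp => (hB p (by omega)).trans (BFun_left hp)
  have hb : ∀ {p}, p < m → pv β (i + p) = pv τ' p + pv σ' i :=
    fun {p} hp => (hB _ (by omega)).trans (BFun_block hp)
  have hr : ∀ {p}, i < p → p < n → pv β (p + m - 1) = avv m (pv σ' i) (pv σ' p) :=
    fun {p} hip hp => (hB _ (by omega)).trans (BFun_right hm hip)
  have hne : ∀ {p}, p < n → p ≠ i → pv σ' p ≠ pv σ' i :=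
    fun {p} hp h e => h (pv_inj σ' hp hi e)
  obtain ⟨x, hx, hxa⟩ := hadj.bounds.exists_min
  obtain ⟨y, hy, hyb⟩ := hadj.bounds.exists_max
  have hτ' := fun {p} => pv_lt τ' (p := p)
  simp only [wle_iff]
  constructor
  · intro h
    constructor
    · intro p q hpq hq hinv
      rw [hadj.outer p q hpq hq, contractInv]
      have hp := hpq.trans hq
      rcases lt_trichotomy p i with hpi | hpi | hpi <;>
        rcases lt_trichotomy q i with hqi | hqi | hqi <;> try omega
      · have := h p q hpq (by omega)
        rw [hl hpi, hl hqi, avv_lt_avv_iff hm] at this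
        simpa only [hqi, if_true] using this hinv
      · have := h p (i + y) (by omega) (by omega)
        rw [hl hpi, hb hy, hyb, add_lt_avv_iff (hτ' hy) (hne hp hpi.ne)] at this
        simpa only [hqi, lt_irrefl, if_false, if_true] using this (hqi ▸ hinv)
      · have h1 := h p (q + m - 1) (by omega) (by omega)
        have h2 := h p (i + y) (by omega) (by omega)
        have h3 := h (i + x) (q + m - 1) (by omega) (by omega)
        rw [hl hpi, hr hqi hq, avv_lt_avv_iff hm] at h1
        rw [hl hpi, hb hy, hyb, add_lt_avv_iff (hτ' hy) (hne hp hpi.ne)] at h2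
        rw [hb hx, hr hqi hq, hxa, avv_lt_add_iff (hτ' hx)] at h3
        simp only [hqi.not_gt, hqi.ne', hpi, if_false, if_true]
        have := hne hp hpi.ne
        refine ⟨h1 hinv, ?_⟩
        rcases lt_or_ge (pv σ' i) (pv σ' p) with h4 | h4
        · exact .inl (h2 h4)
        · exact .inr (h3 (by omega))
      · have h3 := h (i + x) (q + m - 1) (by omega) (by omega)
        rw [hb hx, hr hqi hq, hxa, avv_lt_add_iff (hτ' hx)] at h3
        simpa only [hpi, hqi.not_gt, hqi.ne', lt_irrefl, if_false, if_true] using h3 (hpi ▸ hinv)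
      · have := h (p + m - 1) (q + m - 1) (by omega) (by omega)
        rw [hr hpi hp, hr hqi hq, avv_lt_avv_iff hm] at this
        simpa only [hqi.not_gt, hqi.ne', hpi.ne', hpi.not_gt, if_false] using this hinv
    · intro p q hpq hq hinv
      have := h (i + p) (i + q) (by omega) (by omega)
      rw [hb hq, hb (hpq.trans hq)] at this
      rw [hadj.block q p hq (hpq.trans hq)]
      omega
  · rintro ⟨hσ, hτ⟩ p q hpq hq hinv
    have hle := hadj.bounds.le
    have ho := hadj.outer
    simp only [contractInv] at ho
    rcases position_cases hm i (hpq.trans hq) with hp | ⟨p, hp, rfl⟩ | ⟨p, hip, hp, rfl⟩ <;>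
      rcases position_cases hm i hq with hq' | ⟨q, hq', rfl⟩ | ⟨q, hiq, hq', rfl⟩ <;> try omega
    · rw [hl hp, hl hq', avv_lt_avv_iff hm] at hinv
      have := (ho p q hpq (by omega)).1 (hσ p q hpq (by omega) hinv)
      simpa only [hq', if_true] using this
    · rw [hl hp, hb hq', add_lt_avv_iff (hτ' hq') (hne (hp.trans hi) hp.ne)] at hinv
      have := (ho p i hp hi).1 (hσ p i hp hi hinv)
      simp only [lt_irrefl, if_false, if_true] at this
      exact (hle q hq').2.trans_lt this
    · rw [hl hp, hr hiq hq', avv_lt_avv_iff hm] at hinv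
      have := (ho p q (by omega) hq').1 (hσ p q (by omega) hq' hinv)
      simp only [hiq.not_gt, hiq.ne', hp, if_false, if_true] at this
      exact this.1
    · rw [hb hp, hb hq'] at hinv
      rw [← hadj.block q p hq' hp]
      exact hτ p q (by omega) hq' (by omega)
    · rw [hb hp, hr hiq hq', avv_lt_add_iff (hτ' hp)] at hinv
      have := (ho i q hiq hq').1 (hσ i q hiq hq' hinv)
      simp only [hiq.not_gt, hiq.ne', lt_irrefl, if_false, if_true] at this
      exact this.trans_le (hle p hp).1
    · rw [hr hip hp, hr hiq hq', avv_lt_avv_iff hm] at hinv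
      have := (ho p q (by omega) hq').1 (hσ p q (by omega) hq' hinv)
      simpa only [hiq.not_gt, hiq.ne', hip.not_gt, hip.ne', if_false] using this

end Adjoint

section Top

variable {n m i a b : ℕ} {σ : Perm (Fin n)} {τ : Perm (Fin m)} {ρ θ : Perm (Fin (n + m - 1))}

theorem mem_bL1_of_lt (hm : 1 ≤ m) {x : ℕ} (hx : x < pv σ i) : x ∈ bL1 i σ τ ↔ ∃ p < i, pv σ p = x := by
  constructor
  · rintro ⟨p, hp : p < i, rfl⟩
    refine ⟨p, hp, ?_⟩
    rw [BFun_left hp, avv] at hx ⊢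
    split_ifs at hx ⊢ <;> omega
  · rintro ⟨p, hp, rfl⟩
    exact ⟨p, hp, by rw [BFun_left hp, avv, if_pos hx]⟩

theorem mem_bL3_of_lt (hm : 1 ≤ m) {x : ℕ} (hx : pv σ i < x) :
    x + m - 1 ∈ bL3 i σ τ ↔ ∃ p, i < p ∧ p < n ∧ pv σ p = x := by
  constructor
  · rintro ⟨p, ⟨hp, hpn⟩, h⟩
    obtain ⟨q, rfl⟩ : ∃ q, p = q + m - 1 := ⟨p + 1 - m, by omega⟩
    refine ⟨q, by omega, by omega, ?_⟩
    rw [BFun_right hm (by omega), avv] at h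
    split_ifs at h <;> omega
  · rintro ⟨p, hip, hp, rfl⟩
    exact ⟨p + m - 1, ⟨by omega, by omega⟩, by
      rw [BFun_right hm hip, avv, if_neg (by omega)]⟩

theorem kpar_spec (hm : 1 ≤ m) (i : ℕ) (σ : Perm (Fin n)) (τ : Perm (Fin m)) :
    kpar i σ τ ≤ pv σ i ∧
      ∀ x, pv σ i - kpar i σ τ ≤ x → x < pv σ i → ∃ p < i, pv σ p = x := by
  have h := Nat.sSup_mem (s := {j | j ≤ i ∧ j ≤ pv σ i ∧
    Set.Icc (pv σ i - j) (pv σ i) ⊆ insert (pv σ i) (bL1 i σ τ)})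
    ⟨0, by simp⟩ ⟨i, fun j hj => hj.1⟩
  refine ⟨h.2.1, fun x hx hxs => ?_⟩
  rw [← mem_bL1_of_lt hm hxs (τ := τ)]
  exact (h.2.2 ⟨hx, hxs.le⟩).resolve_left hxs.ne

theorem sub_kpar_le (hm : 1 ≤ m) {y : ℕ} (hy : y < pv σ i)
    (h : ∀ x, y ≤ x → x < pv σ i → ∃ p < i, pv σ p = x) : pv σ i - kpar i σ τ ≤ y := by
  suffices pv σ i - y ≤ kpar i σ τ by omega
  refine le_csSup ⟨i, fun j hj => hj.1⟩ ⟨?_, by omega, ?_⟩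
  · have hsub : Finset.Ico y (pv σ i) ⊆ (Finset.range i).image (pv σ) := by
      intro x hx
      rw [Finset.mem_Ico] at hx
      simpa using h x hx.1 hx.2
    have := (Finset.card_le_card hsub).trans Finset.card_image_le
    simpa using this
  · rintro x ⟨hx, hxs⟩
    rcases hxs.eq_or_lt with rfl | hxs
    · exact .inl rfl
    · exact .inr ((mem_bL1_of_lt hm hxs).2 (h x (by omega) hxs))

theorem lpar_spec (hm : 1 ≤ m) (i : ℕ) (σ : Perm (Fin n)) (τ : Perm (Fin m)) {x : ℕ}
    (hx : pv σ i < x) (hxl : x ≤ pv σ i + lpar i σ τ) : ∃ p, i < p ∧ p < n ∧ pv σ p = x := by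
  have h := Nat.sSup_mem (s := {j | j ≤ n - 1 - i ∧
    Set.Icc (pv σ i + m - 1) (pv σ i + m - 1 + j) ⊆ insert (pv σ i + m - 1) (bL3 i σ τ)})
    ⟨0, by simp⟩ ⟨n - 1 - i, fun j hj => hj.1⟩
  rw [← mem_bL3_of_lt hm hx (τ := τ)]
  refine (h.2 ⟨by omega, ?_⟩).resolve_left (by omega)
  change _ ≤ _ + lpar i σ τ
  omega

theorem le_add_lpar (hm : 1 ≤ m) {y : ℕ} (hy : pv σ i < y)
    (h : ∀ x, pv σ i < x → x ≤ y → ∃ p, i < p ∧ p < n ∧ pv σ p = x) :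
    y ≤ pv σ i + lpar i σ τ := by
  suffices y - pv σ i ≤ lpar i σ τ by omega
  refine le_csSup ⟨n - 1 - i, fun j hj => hj.1⟩ ⟨?_, ?_⟩
  · have hsub : Finset.Ioc (pv σ i) y ⊆ (Finset.Ioo i n).image (pv σ) := by
      intro x hx
      rw [Finset.mem_Ioc] at hx
      simpa [and_assoc] using h x hx.1 hx.2
    have := (Finset.card_le_card hsub).trans Finset.card_image_le
    simp only [Nat.card_Ioc, Nat.card_Ioo] at this
    omega
  · rintro x ⟨hx, hxs⟩
    rcases hx.eq_or_lt with rfl | hx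
    · exact .inl rfl
    · obtain ⟨z, rfl⟩ : ∃ z, x = z + m - 1 := ⟨x + 1 - m, by omega⟩
      exact .inr ((mem_bL3_of_lt hm (by omega)).2 (h z (by omega) (by omega)))

theorem add_lpar_lt (hm : 1 ≤ m) (hi : i < n) (σ : Perm (Fin n)) (τ : Perm (Fin m)) {p : ℕ} (hp : p < i)
    (h : pv σ i < pv σ p) : pv σ i + lpar i σ τ < pv σ p := by
  by_contra hn
  obtain ⟨q, hq, hqn, he⟩ := lpar_spec hm i σ τ h (not_lt.1 hn)
  have := pv_inj σ hqn (hp.trans hi) he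
  omega

theorem lt_sub_kpar (hm : 1 ≤ m) (hi : i < n) (σ : Perm (Fin n)) (τ : Perm (Fin m)) {p : ℕ} (hip : i < p)
    (hp : p < n) (h : pv σ p < pv σ i) : pv σ p < pv σ i - kpar i σ τ := by
  by_contra hn
  obtain ⟨q, hq, he⟩ := (kpar_spec hm i σ τ).2 _ (not_lt.1 hn) h
  have := pv_inj σ (hq.trans hi) hp he
  omega

/-- If `g` orders `S` as `f` does and `φ` maps the image of `f` increasingly onto that of `g`,
then `g = φ ∘ f` on `S`. -/
theorem eq_comp_of_image_eq {S : Set ℕ} {f g φ : ℕ → ℕ}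
    (hlt : ∀ p q, p ∈ S → q ∈ S → (g p < g q ↔ f p < f q))
    (hφ : ∀ x ∈ f '' S, ∀ y ∈ f '' S, x < y → φ x < φ y)
    (him : g '' S = φ '' (f '' S)) : ∀ p ∈ S, g p = φ (f p) := by
  refine eq_of_lt_iff_of_image_eq (fun p hp q hq => ?_) (him.trans (Set.image_image _ _ _))
  rw [hlt p q hp hq]
  refine ⟨hφ _ ⟨p, hp, rfl⟩ _ ⟨q, hq, rfl⟩, fun h => ?_⟩
  by_contra hn
  rcases (not_lt.1 hn).eq_or_lt with he | hl
  · exact h.ne (congrArg φ he.symm)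
  · exact h.asymm (hφ _ ⟨q, hq, rfl⟩ _ ⟨p, hp, rfl⟩ hl)

theorem IsT.apply_left (hm : 2 ≤ m) (hi : i < n) (hT : IsT i σ τ θ) {p : ℕ} (hp : p < i) :
    pv θ p = if pv σ p < pv σ i - kpar i σ τ then pv σ p
      else if pv σ p < pv σ i then pv σ p + m - 1 + lpar i σ τ else pv σ p + m - 1 := by
  rw [IsT, if_neg (by omega)] at hT
  obtain ⟨hlt, -, -, him, -, -⟩ := hT
  obtain ⟨hk, hks⟩ := kpar_spec (by omega : 1 ≤ m) i σ τ
  have hne : ∀ p < i, pv σ p ≠ pv σ i := fun p hp e => hp.ne (pv_inj σ (hp.trans hi) hi e)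
  have key := eq_comp_of_image_eq (S := {p | p < i}) (f := BFun i σ τ) (g := pv θ)
    (φ := fun x => if x < pv σ i - kpar i σ τ then x
      else if x < pv σ i then x + m - 1 + lpar i σ τ else x) (fun p q hp hq => hlt p q hp hq) ?_ ?_
  · rw [key p hp, BFun_left hp, avv]
    split_ifs <;> omega
  · rintro _ ⟨p, hp : p < i, rfl⟩ _ ⟨q, hq : q < i, rfl⟩
    have := hne q hq
    have := fun h => add_lpar_lt (by omega) hi σ τ hq h
    simp only [BFun_left hp, BFun_left hq, avv]
    split_ifs <;> omega
  · rw [him]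
    change _ = _ '' bL1 i σ τ
    ext x
    simp only [Set.mem_union, Set.mem_image, Set.mem_Ico]
    constructor
    · rintro ((⟨hx, hlt⟩ | hx) | ⟨hx, hlt⟩)
      · exact ⟨x, hx, by rw [if_pos hlt]⟩
      · obtain ⟨p, hp, he⟩ := hks (x - (m - 1 + lpar i σ τ)) (by omega) (by omega)
        refine ⟨_, (mem_bL1_of_lt (by omega) (by omega)).2 ⟨p, hp, he⟩, ?_⟩
        split_ifs <;> omega
      · exact ⟨x, hx, by rw [if_neg (by omega), if_neg (by omega)]⟩
    · rintro ⟨y, hy, rfl⟩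
      split_ifs with h1 h2
      · exact .inl (.inl ⟨hy, h1⟩)
      · exact .inl (.inr (by omega))
      · refine .inr ⟨hy, lt_of_le_of_ne (by omega) ?_⟩
        obtain ⟨p, hp : p < i, rfl⟩ := hy
        have := hne p hp
        rw [BFun_left hp, avv]
        split_ifs <;> omega

theorem IsT.apply_right (hm : 2 ≤ m) (hi : i < n) (hT : IsT i σ τ θ) {p : ℕ} (hip : i < p)
    (hp : p < n) :
    pv θ (p + m - 1) = if pv σ p < pv σ i then pv σ p
      else if pv σ p ≤ pv σ i + lpar i σ τ then pv σ p - kpar i σ τ else pv σ p + m - 1 := by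
  rw [IsT, if_neg (by omega)] at hT
  obtain ⟨-, -, hlt, -, -, him⟩ := hT
  have hk := (kpar_spec (by omega : 1 ≤ m) i σ τ).1
  have hls := fun {x} => lpar_spec (by omega : 1 ≤ m) i σ τ (x := x)
  have hm' : 1 ≤ m := by omega
  have hcov : ∀ r, i + m ≤ r → r < n + m - 1 → ∃ q, i < q ∧ q < n ∧ r = q + m - 1 :=
    fun r h1 h2 => ⟨r + 1 - m, by omega, by omega, by omega⟩
  have hne : ∀ p, i < p → p < n → pv σ p ≠ pv σ i := fun p h1 h2 e => h1.ne' (pv_inj σ h2 hi e)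
  have key := eq_comp_of_image_eq (S := {p | i + m ≤ p ∧ p < n + m - 1}) (f := BFun i σ τ)
    (g := pv θ) (φ := fun x => if x < pv σ i + m - 1 then x
      else if x ≤ pv σ i + m - 1 + lpar i σ τ then x - (m - 1) - kpar i σ τ else x)
    (fun p q hp hq => hlt p q hp.1 hp.2 hq.1 hq.2) ?_ ?_
  · rw [key (p + m - 1) ⟨by omega, by omega⟩, BFun_right hm' hip, avv]
    split_ifs <;> omega
  · rintro _ ⟨p, ⟨hp, hp'⟩, rfl⟩ _ ⟨q, ⟨hq, hq'⟩, rfl⟩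
    obtain ⟨p, h1, h2, rfl⟩ := hcov p hp hp'
    obtain ⟨q, h3, h4, rfl⟩ := hcov q hq hq'
    have := fun h => lt_sub_kpar hm' hi σ τ h1 h2 h
    have := hne q h3 h4
    simp only [BFun_right hm' h1, BFun_right hm' h3, avv]
    split_ifs <;> omega
  · rw [him]
    change _ = _ '' bL3 i σ τ
    ext x
    simp only [Set.mem_union, Set.mem_image, Set.mem_Ioc]
    constructor
    · rintro ((⟨hx, hlt⟩ | hx) | ⟨hx, hlt⟩)
      · exact ⟨x, hx, by rw [if_pos hlt]⟩
      · obtain ⟨p, hip, hp, he⟩ := hls (x := x + kpar i σ τ) (by omega) (by omega)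
        refine ⟨_, (mem_bL3_of_lt hm' (x := x + kpar i σ τ) (by omega)).2 ⟨p, hip, hp, he⟩, ?_⟩
        split_ifs <;> omega
      · exact ⟨x, hx, by rw [if_neg (by omega), if_neg (by omega)]⟩
    · rintro ⟨y, hy, rfl⟩
      split_ifs with h1 h2
      · exact .inl (.inl ⟨hy, h1⟩)
      · obtain ⟨p, ⟨hp, hp'⟩, rfl⟩ := hy
        obtain ⟨p, h3, h4, rfl⟩ := hcov p hp hp'
        have := hne p h3 h4
        rw [BFun_right hm' h3, avv] at *
        refine .inl (.inr ?_)
        split_ifs at * <;> omega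
      · exact .inr ⟨hy, by omega⟩

theorem IsT.apply_block (hm : 2 ≤ m) (hT : IsT i σ τ θ) {p : ℕ} (hp : p < m) :
    pv θ (i + p) = if pv τ p = 0 then pv σ i - kpar i σ τ
      else if pv τ p = m - 1 then pv σ i + m - 1 + lpar i σ τ
      else pv σ i + pv τ p - kpar i σ τ + lpar i σ τ := by
  rw [IsT, if_neg (by omega)] at hT
  obtain ⟨-, hlt, -, -, him, -⟩ := hT
  obtain ⟨hk, -⟩ := kpar_spec (by omega : 1 ≤ m) i σ τ
  have hf : BFun i σ τ '' {p | i ≤ p ∧ p < i + m} = Set.Ico (pv σ i) (pv σ i + m) := by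
    ext x
    simp only [Set.mem_image, Set.mem_ofPred_eq, Set.mem_Ico]
    constructor
    · rintro ⟨p, ⟨hp, hp'⟩, rfl⟩
      obtain ⟨p, rfl⟩ := Nat.exists_eq_add_of_le hp
      rw [BFun_block (by omega)]
      have := pv_lt τ (p := p) (by omega)
      omega
    · rintro ⟨h1, h2⟩
      obtain ⟨p, hp, he⟩ := exists_pv_eq τ (x := x - pv σ i) (by omega)
      exact ⟨i + p, by omega, by rw [BFun_block hp]; omega⟩
  have key := eq_comp_of_image_eq (S := {p | i ≤ p ∧ p < i + m}) (f := BFun i σ τ)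
    (g := pv θ) (φ := fun x => if x = pv σ i then pv σ i - kpar i σ τ
      else if x = pv σ i + m - 1 then pv σ i + m - 1 + lpar i σ τ
      else x - kpar i σ τ + lpar i σ τ)
    (fun p q hp hq => hlt p q hp.1 hp.2 hq.1 hq.2) ?_ ?_
  · rw [key (i + p) ⟨by omega, by omega⟩, BFun_block hp]
    split_ifs <;> omega
  · rw [hf]
    rintro x ⟨hx, hx'⟩ y ⟨hy, hy'⟩ hxy
    split_ifs <;> omega
  · rw [him, hf]
    ext x
    simp only [Set.mem_insert_iff, Set.mem_image, Set.mem_Ico, Set.mem_Ioo]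
    constructor
    · rintro (rfl | rfl | hx)
      · exact ⟨pv σ i, by omega, by simp⟩
      · exact ⟨pv σ i + m - 1, by omega, by rw [if_neg (by omega), if_pos rfl]⟩
      · exact ⟨x + kpar i σ τ - lpar i σ τ, by omega, by
          rw [if_neg (by omega), if_neg (by omega)]; omega⟩
    · rintro ⟨y, hy, rfl⟩
      split_ifs <;> omega

end Top

section Fiber

variable {n m i a b : ℕ} {σ σ' : Perm (Fin n)} {τ τ' : Perm (Fin m)}
  {ρ θ β : Perm (Fin (n + m - 1))}

theorem IsAdjoint.wle_of_isT (hm : 1 ≤ m) (hi : i < n) (hT : IsT i σ τ θ)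
    (hadj : IsAdjoint i a b θ σ' τ') : wle σ' σ ∧ wle τ' τ := by
  have hτ := fun {p} => pv_lt τ (p := p)
  have hne : ∀ {p}, p < n → p ≠ i → pv σ p ≠ pv σ i := fun {p} hp h e => h (pv_inj σ hp hi e)
  have hle := hadj.bounds.le
  simp only [wle_iff]
  constructor
  · intro p q hpq hq hinv
    have hp := hpq.trans hq
    rw [hadj.outer p q hpq hq, contractInv] at hinv
    by_cases hm1 : m = 1
    · subst hm1
      rw [IsT, if_pos rfl] at hT
      have h0 := hle 0 one_pos
      simp only [hT, Nat.add_sub_cancel, add_zero] at hinv h0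
      split_ifs at hinv with h1 h2 h3 h4
      · exact hinv
      · rw [h2]
        exact h0.2.trans_lt hinv
      · exact hinv.1
      · rw [h4]
        exact hinv.trans_le h0.1
      · exact hinv
    · have hm2 : 2 ≤ m := by omega
      have hl := fun {p} => hT.apply_left hm2 hi (p := p)
      have hb := fun {p} => hT.apply_block hm2 (p := p)
      have hr := fun {p} => hT.apply_right hm2 hi (p := p)
      have ha : a ≤ pv σ i - kpar i σ τ := by
        obtain ⟨x, hx, h⟩ := exists_pv_eq τ (x := 0) (by omega)
        simpa only [hb hx, h, if_true] using (hle x hx).1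
      have hb : pv σ i + m - 1 + lpar i σ τ ≤ b := by
        obtain ⟨x, hx, h⟩ := exists_pv_eq τ (x := m - 1) (by omega)
        simpa only [hb hx, h, if_true, show m - 1 ≠ 0 by omega, if_false] using (hle x hx).2
      rcases lt_trichotomy p i with hpi | hpi | hpi <;>
        rcases lt_trichotomy q i with hqi | hqi | hqi <;> try omega
      · simp only [hqi, if_true, hl hpi, hl hqi] at hinv
        have := fun h => add_lpar_lt hm hi σ τ hqi h
        have := hne hp hpi.ne
        have := hne hq hqi.ne
        split_ifs at hinv <;> omega
      · simp only [hqi, lt_irrefl, if_false, if_true, hl hpi] at hinv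
        have := hne hp hpi.ne
        rw [hqi]
        split_ifs at hinv <;> omega
      · simp only [hqi.not_gt, hqi.ne', hpi, if_false, if_true, hl hpi, hr hqi hq] at hinv
        have := hne hp hpi.ne
        have := hne hq hqi.ne'
        split_ifs at hinv <;> omega
      · simp only [hqi.not_gt, hqi.ne', hpi, lt_irrefl, if_false, if_true, hr hqi hq] at hinv
        have := hne hq hqi.ne'
        rw [hpi]
        split_ifs at hinv <;> omega
      · simp only [hqi.not_gt, hqi.ne', hpi.not_gt, hpi.ne', if_false, hr hqi hq, hr hpi hp]
          at hinv
        have := fun h => lt_sub_kpar hm hi σ τ hpi hp h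
        have := hne hp hpi.ne'
        have := hne hq hqi.ne'
        split_ifs at hinv <;> omega
  · intro p q hpq hq hinv
    have hp := hpq.trans hq
    rw [hadj.block q p hq hp] at hinv
    have hm2 : 2 ≤ m := by omega
    obtain ⟨hk, -⟩ := kpar_spec hm i σ τ
    rw [hT.apply_block hm2 hp, hT.apply_block hm2 hq] at hinv
    have := hτ hp
    have := hτ hq
    split_ifs at hinv <;> omega

theorem IsAdjoint.wle_isT (hm : 1 ≤ m) (hi : i < n) (hT : IsT i σ τ θ)
    (hadj : IsAdjoint i a b ρ σ τ) : wle ρ θ := by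
  have hle := hadj.bounds.le
  have ho := hadj.outer
  have hτ := fun {p} => pv_lt τ (p := p)
  have hne : ∀ {p q}, p < n → q < n → p ≠ q → pv σ p ≠ pv σ q :=
    fun {p q} hp hq h e => h (pv_inj σ hp hq e)
  obtain ⟨x, hx, hxa⟩ := hadj.bounds.exists_min
  obtain ⟨y, hy, hyb⟩ := hadj.bounds.exists_max
  have hρne : ∀ {p q}, p < n + m - 1 → q < n + m - 1 → p ≠ q → pv ρ p ≠ pv ρ q :=
    fun {p q} hp hq h e => h (pv_inj ρ hp hq e)
  have hll : ∀ {p q}, p < q → q < i → (pv σ q < pv σ p ↔ pv ρ q < pv ρ p) := by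
    intro p q hpq hq
    rw [ho p q hpq (hq.trans hi), contractInv, if_pos hq]
  have hlb : ∀ {p}, p < i → (pv σ i < pv σ p ↔ b < pv ρ p) := by
    intro p hp
    rw [ho p i hp hi, contractInv, if_neg (lt_irrefl i), if_pos rfl]
  have hlr : ∀ {p q}, p < i → i < q → q < n → (pv σ q < pv σ p ↔
      pv ρ (q + m - 1) < pv ρ p ∧ (b < pv ρ p ∨ pv ρ (q + m - 1) < a)) := by
    intro p q hp hq hqn
    rw [ho p q (hp.trans hq) hqn, contractInv, if_neg hq.not_gt, if_neg hq.ne', if_pos hp]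
  have hbr : ∀ {q}, i < q → q < n → (pv σ q < pv σ i ↔ pv ρ (q + m - 1) < a) := by
    intro q hq hqn
    rw [ho i q hq hqn, contractInv, if_neg hq.not_gt, if_neg hq.ne', if_neg (lt_irrefl i),
      if_pos rfl]
  have hrr : ∀ {p q}, i < p → p < q → q < n →
      (pv σ q < pv σ p ↔ pv ρ (q + m - 1) < pv ρ (p + m - 1)) := by
    intro p q hp hpq hqn
    have hq := hp.trans hpq
    rw [ho p q hpq hqn, contractInv, if_neg hq.not_gt, if_neg hq.ne', if_neg hp.not_gt,
      if_neg hp.ne']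
  have hbb := hadj.block
  rw [wle_iff]
  intro p q hpq hq hinv
  by_cases hm1 : m = 1
  · subst hm1
    rw [IsT, if_pos rfl] at hT
    rw [hT, hT, ho p q hpq hq, contractInv]
    have h0 := hle 0 one_pos
    have : x = 0 := by omega
    have : y = 0 := by omega
    subst x y
    simp only [Nat.add_sub_cancel, add_zero] at *
    subst hxa hyb
    split_ifs with h1 h2 h3 h4
    · exact hinv
    · exact h2 ▸ hinv
    · have := hρne (p := p) (q := i) (by omega) (by omega) (by omega)
      have := hρne (p := q) (q := i) (by omega) (by omega) (by omega)
      omega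
    · exact h4 ▸ hinv
    · exact hinv
  have hm2 : 2 ≤ m := by omega
  have hTl := fun {p} => hT.apply_left hm2 hi (p := p)
  have hTb := fun {p} => hT.apply_block hm2 (p := p)
  have hTr := fun {p} => hT.apply_right hm2 hi (p := p)
  have hk := (kpar_spec hm i σ τ).1
  have hrunl : ∀ {p}, p < i → a ≤ pv ρ p → pv ρ p ≤ b →
      pv σ i - kpar i σ τ ≤ pv σ p ∧ pv σ p < pv σ i := by
    intro p hp h1 h2
    have h3 : pv σ p < pv σ i := by
      have := hlb hp
      have := hne (hp.trans hi) hi hp.ne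
      omega
    refine ⟨sub_kpar_le hm h3 fun z hz hz' => ?_, h3⟩
    obtain ⟨r, hr, rfl⟩ := exists_pv_eq σ (hz'.trans (pv_lt σ hi))
    rcases lt_trichotomy r i with h | rfl | h
    · exact ⟨r, h, rfl⟩
    · omega
    · have h4 := hlr hp h hr
      have h5 := hbr h hr
      omega
  have hrunr : ∀ {q}, i < q → q < n → a ≤ pv ρ (q + m - 1) → pv ρ (q + m - 1) ≤ b →
      pv σ i < pv σ q ∧ pv σ q ≤ pv σ i + lpar i σ τ := by
    intro q hq hqn h1 h2
    have h3 : pv σ i < pv σ q := by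
      have := hbr hq hqn
      have := hne hqn hi hq.ne'
      omega
    refine ⟨h3, le_add_lpar hm h3 fun z hz hz' => ?_⟩
    obtain ⟨r, hr, rfl⟩ := exists_pv_eq σ (hz'.trans_lt (pv_lt σ hqn))
    rcases lt_trichotomy r i with h | rfl | h
    · have h4 := hlr h hq hqn
      have h5 := hlb h
      have := hne (h.trans hi) hqn (h.trans hq).ne
      omega
    · omega
    · exact ⟨r, h, hr, rfl⟩
  rcases position_cases hm i (hpq.trans hq) with hp | ⟨p, hp, rfl⟩ | ⟨p, hip, hp, rfl⟩ <;>
    rcases position_cases hm i hq with hq' | ⟨q, hq', rfl⟩ | ⟨q, hiq, hq', rfl⟩ <;> try omega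
  · have := (hll hpq hq').2 hinv
    have := hne (hp.trans hi) hi hp.ne
    have := fun h => add_lpar_lt hm hi σ τ hp h
    rw [hTl hp, hTl hq']
    split_ifs <;> omega
  · have h1 := hle q hq'
    have h2 := hτ hq'
    rw [hTl hp, hTb hq']
    by_cases h3 : b < pv ρ p
    · have := (hlb hp).2 h3
      have := add_lpar_lt hm hi σ τ hp this
      split_ifs <;> omega
    · have h4 := hrunl hp (by omega) (by omega)
      have h5 := (hbb q y hq' hy).2 (by omega)
      have := hτ hy
      split_ifs <;> omega
  · rw [hTl hp, hTr hiq hq']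
    have h1 := hlr hp hiq hq'
    by_cases h2 : pv σ q < pv σ p
    · split_ifs <;> omega
    · have h5 := hne (hp.trans hi) hq' (hp.trans hiq).ne
      have h3 := hrunl hp
      have h4 := hrunr hiq hq'
      split_ifs <;> omega
  · have h1 := (hbb q p hq' hp).2 hinv
    have := hτ hp
    rw [hTb hp, hTb hq']
    split_ifs <;> omega
  · have h1 := hle p hp
    have h2 := hτ hp
    rw [hTb hp, hTr hiq hq']
    by_cases h3 : pv ρ (q + m - 1) < a
    · have := (hbr hiq hq').2 h3
      have := lt_sub_kpar hm hi σ τ hiq hq' this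
      split_ifs <;> omega
    · have h4 := hrunr hiq hq' (by omega) (by omega)
      have h5 := (hbb x p hx hp).2 (by omega)
      split_ifs <;> omega
  · have := (hrr hip (by omega) hq').2 hinv
    rw [hTr hip hp, hTr hiq hq']
    have := hne hp hi hip.ne'
    have := fun h => lt_sub_kpar hm hi σ τ hiq hq' h
    split_ifs <;> omega

theorem IsAdjoint.eq_iff_mem_interval (hm : 1 ≤ m) (hi : i < n) (hB : IsB i σ τ β)
    (hT : IsT i σ τ θ) (hadj : IsAdjoint i a b ρ σ' τ')
    (hBp : ∃ β', IsB i σ' τ' β') :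
    (σ = σ' ∧ τ = τ') ↔ wle β ρ ∧ wle ρ θ := by
  constructor
  · rintro ⟨rfl, rfl⟩
    exact ⟨(wle_iff_of_isAdjoint hm hi hB hadj).2 ⟨wle_refl _, wle_refl _⟩,
      hadj.wle_isT hm hi hT⟩
  · rintro ⟨h₁, h₂⟩
    obtain ⟨hσ, hτ⟩ := (wle_iff_of_isAdjoint hm hi hB hadj).1 h₁
    obtain ⟨β', hB'⟩ := hBp
    obtain ⟨a', b', σ'', τ'', hadj'⟩ := exists_isAdjoint hm hi θ
    have h₃ := (wle_iff_of_isAdjoint hm hi hB' hadj).2 ⟨wle_refl _, wle_refl _⟩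
    obtain ⟨hσ', hτ'⟩ := (wle_iff_of_isAdjoint hm hi hB' hadj').1 (wle_trans h₃ h₂)
    obtain ⟨hσ'', hτ''⟩ := hadj'.wle_of_isT hm hi hT
    exact ⟨wle_antisymm hσ (wle_trans hσ' hσ''), wle_antisymm hτ (wle_trans hτ' hτ'')⟩

end Fiber

section Zeta

variable {N : ℕ}

/-- The functional sending `F_ρ` to `1` if `ρ ≤ π` and to `0` otherwise. -/
noncomputable def zetaFunctional (π : Perm (Fin N)) : (Perm (Fin N) →₀ ℤ) →ₗ[ℤ] ℤ :=
  Finsupp.linearCombination ℤ fun ρ => if wle ρ π then (1 : ℤ) else 0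

theorem zetaFunctional_single (π ρ : Perm (Fin N)) (c : ℤ) :
    zetaFunctional π (Finsupp.single ρ c) = if wle ρ π then c else 0 := by
  simp [zetaFunctional, Finsupp.linearCombination_single]

theorem zetaFunctional_apply (π : Perm (Fin N)) (x : Perm (Fin N) →₀ ℤ) :
    zetaFunctional π x = ∑ ρ, if wle ρ π then x ρ else 0 := by
  rw [zetaFunctional, Finsupp.linearCombination_apply, Finsupp.sum_fintype _ _ (by simp)]
  simp

variable {mu : ∀ N : ℕ, Perm (Fin N) → Perm (Fin N) → ℤ}

theorem Msig_apply (f : Perm (Fin N) → Perm (Fin N) → ℤ) (σ ρ : Perm (Fin N)) :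
    Msig f σ ρ = if wle σ ρ then f σ ρ else 0 := by
  simp [Msig, Finsupp.finsetSum_apply, Finsupp.single_apply, Finset.sum_ite_eq']

theorem zetaFunctional_Msig (hmu : IsMoebius mu) (σ π : Perm (Fin N)) :
    zetaFunctional π (Msig (mu N) σ) = if σ = π then 1 else 0 := by
  rw [zetaFunctional_apply]
  by_cases h : wle σ π
  · rw [← hmu N σ π h, Finset.sum_filter]
    refine Finset.sum_congr rfl fun ρ _ => ?_
    rw [Msig_apply]
    split_ifs <;> tauto
  · rw [if_neg (by rintro rfl; exact h (wle_refl _))]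
    refine Finset.sum_eq_zero fun ρ _ => ?_
    rw [Msig_apply]
    split_ifs with h1 h2
    · exact absurd (wle_trans h2 h1) h
    all_goals rfl

theorem ext_zetaFunctional (hmu : IsMoebius mu) {x y : Perm (Fin N) →₀ ℤ}
    (h : ∀ π, zetaFunctional π x = zetaFunctional π y) : x = y := by
  let A : Matrix (Perm (Fin N)) (Perm (Fin N)) ℤ := .of fun σ ρ => Msig (mu N) σ ρ
  let Z : Matrix (Perm (Fin N)) (Perm (Fin N)) ℤ := .of fun ρ π => if wle ρ π then 1 else 0
  have hZ : ∀ (z : Perm (Fin N) →₀ ℤ) π, (Matrix.vecMul z Z) π = zetaFunctional π z := by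
    intro z π
    simp [Matrix.vecMul, dotProduct, zetaFunctional_apply, Z]
  have hAZ : A * Z = 1 := by
    ext σ π
    rw [Matrix.one_apply, ← zetaFunctional_Msig hmu, ← hZ]
    rfl
  have hxy : Matrix.vecMul x Z = Matrix.vecMul y Z := by
    ext π
    rw [hZ, hZ, h]
  have := congrArg (Matrix.vecMul · A) hxy
  simp only [Matrix.vecMul_vecMul, mul_eq_one_comm.1 hAZ, Matrix.vecMul_one] at this
  exact DFunLike.coe_injective this

theorem zetaFunctional_circF {n m : ℕ}
    (Bp : Perm (Fin n) → Perm (Fin m) → Perm (Fin (n + m - 1)))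
    (x : Perm (Fin n) →₀ ℤ) (y : Perm (Fin m) →₀ ℤ) {π : Perm (Fin (n + m - 1))}
    {σ : Perm (Fin n)} {τ : Perm (Fin m)}
    (h : ∀ σ' τ', wle (Bp σ' τ') π ↔ wle σ' σ ∧ wle τ' τ) :
    zetaFunctional π (circF Bp x y) = zetaFunctional σ x * zetaFunctional τ y := by
  rw [circF, Finsupp.sum_fintype _ _ (by simp), map_sum, zetaFunctional_apply σ,
    zetaFunctional_apply τ, Finset.sum_mul_sum]
  refine Finset.sum_congr rfl fun σ' _ => ?_
  rw [Finsupp.sum_fintype _ _ (by simp), map_sum]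
  refine Finset.sum_congr rfl fun τ' _ => ?_
  rw [map_smul, zetaFunctional_single]
  by_cases h₁ : wle σ' σ <;> by_cases h₂ : wle τ' τ <;> simp [h, h₁, h₂]

end Zeta

/-- **Theorem (operad structure on the monomial basis).**
For `σ ∈ S_n`, `τ ∈ S_m` and `1 ≤ i ≤ n` (0-indexed: `i < n`),
`M_σ ∘_i M_τ = Σ_{B_i(σ,τ) ≤ ρ ≤ T_i(σ,τ)} M_ρ`, the sum being over the interval
`[B_i(σ,τ), T_i(σ,τ)]` in the left weak order on `S_{n+m-1}`. -/
theorem operad_M {n m : ℕ} (hn : 1 ≤ n) (hm : 1 ≤ m) (i : ℕ) (hi : i < n)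
    (σ : Equiv.Perm (Fin n)) (τ : Equiv.Perm (Fin m))
    (mu : ∀ N : ℕ, Equiv.Perm (Fin N) → Equiv.Perm (Fin N) → ℤ) (hmu : IsMoebius mu)
    (Bp : Equiv.Perm (Fin n) → Equiv.Perm (Fin m) → Equiv.Perm (Fin (n + m - 1)))
    (hBp : ∀ (σ' : Equiv.Perm (Fin n)) (τ' : Equiv.Perm (Fin m)), IsB i σ' τ' (Bp σ' τ'))
    (ρT : Equiv.Perm (Fin (n + m - 1))) (hρT : IsT i σ τ ρT) :
    circF Bp (Msig (mu n) σ) (Msig (mu m) τ)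
      = ∑ ρ ∈ Finset.univ.filter (fun ρ => wle (Bp σ τ) ρ ∧ wle ρ ρT),
          Msig (mu (n + m - 1)) ρ := by
  refine ext_zetaFunctional hmu fun π => ?_
  obtain ⟨a, b, σ', τ', hadj⟩ := exists_isAdjoint hm hi π
  rw [zetaFunctional_circF Bp _ _ fun σ'' τ'' => wle_iff_of_isAdjoint hm hi (hBp σ'' τ'') hadj,
    zetaFunctional_Msig hmu, zetaFunctional_Msig hmu, map_sum]
  simp only [zetaFunctional_Msig hmu, Finset.sum_ite_eq', Finset.mem_filter, Finset.mem_univ,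
    true_and, ← hadj.eq_iff_mem_interval hm hi (hBp σ τ) hρT ⟨_, hBp σ' τ'⟩]
  by_cases h₁ : σ = σ' <;> by_cases h₂ : τ = τ' <;> simp [h₁, h₂]
end

section
/- Let n,m ≥ 1 and 1 ≤ i ≤ n. The map P_i : S_{n+m−1} → S_n × S_m is order-preserving: if ρ ≤ ρ' in the left weak order on S_{n+m−1}, then P_i(ρ) ≤ P_i(ρ') in the product of the weak orders on S_n × S_m. -/
open Equiv

/-- `u^ρ`: the minimum of the entries of the middle block `L₂(ρ)` (positions `[i, i+m-1]`). -/
noncomputable def uPar {N : ℕ} (i m : ℕ) (ρ : Equiv.Perm (Fin N)) : ℕ :=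
  sInf (pv ρ '' {p | i ≤ p ∧ p < i + m})

/-- `v^ρ`: the maximum of the entries of the middle block `L₂(ρ)`. -/
noncomputable def vPar {N : ℕ} (i m : ℕ) (ρ : Equiv.Perm (Fin N)) : ℕ :=
  sSup (pv ρ '' {p | i ≤ p ∧ p < i + m})

/-- `C_{1,m}^ρ`: the entries of the first block of `ρ` lying strictly between `u^ρ` and `v^ρ`. -/
noncomputable def Cmid1 {N : ℕ} (i m : ℕ) (ρ : Equiv.Perm (Fin N)) : Set ℕ :=
  {x ∈ pv ρ '' {p | p < i} | uPar i m ρ < x ∧ x < vPar i m ρ}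

/-- `C_{3,m}^ρ`: the entries of the third block of `ρ` lying strictly between `u^ρ` and `v^ρ`. -/
noncomputable def Cmid3 {N : ℕ} (i m : ℕ) (ρ : Equiv.Perm (Fin N)) : Set ℕ :=
  {x ∈ pv ρ '' {p | i + m ≤ p ∧ p < N} | uPar i m ρ < x ∧ x < vPar i m ρ}

/-- The sequence `(Bρ(1),…,Bρ(i-1), w, Bρ(i+m),…,Bρ(n+m-1))` of length `n`,
used to produce the first component of `P_i(ρ)` by standardization (here `w = u + n₁`). -/
def concatFun {N : ℕ} (i m w : ℕ) (β : Equiv.Perm (Fin N)) (r : ℕ) : ℕ :=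
  if r < i then pv β r else if r = i then w else pv β (r + m - 1)

/-- `P_i(ρ) = (σ,τ)`: for `m = 1` this means `σ = ρ` and `τ = id`; for `m ≥ 2` it is
expressed via the intermediate permutation `Bρ` (denoted `β`), whose blocks standardize
like those of `ρ` and have the prescribed entry sets, `σ` being the standardization of
`(β(1),…,β(i-1), u+n₁, β(i+m),…,β(n+m-1))` and `τ` the standardization of `L₂(ρ)`. -/
noncomputable def IsP {n m : ℕ} (i : ℕ) (ρ : Equiv.Perm (Fin (n + m - 1)))
    (σ : Equiv.Perm (Fin n)) (τ : Equiv.Perm (Fin m)) : Prop :=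
  if m = 1 then (∀ p : ℕ, pv σ p = pv ρ p) ∧ τ = 1
  else
    ∃ β : Equiv.Perm (Fin (n + m - 1)),
      (∀ p q : ℕ, p < i → q < i → (pv β p < pv β q ↔ pv ρ p < pv ρ q)) ∧
      (∀ p q : ℕ, i ≤ p → p < i + m → i ≤ q → q < i + m →
        (pv β p < pv β q ↔ pv ρ p < pv ρ q)) ∧
      (∀ p q : ℕ, i + m ≤ p → p < n + m - 1 → i + m ≤ q → q < n + m - 1 →
        (pv β p < pv β q ↔ pv ρ p < pv ρ q)) ∧
      pv β '' {p | p < i} =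
        {x ∈ pv ρ '' {p | p < i} | x < uPar i m ρ} ∪
          Set.Ico (uPar i m ρ) (uPar i m ρ + (Cmid1 i m ρ).ncard) ∪
          {x ∈ pv ρ '' {p | p < i} | vPar i m ρ < x} ∧
      pv β '' {p | i ≤ p ∧ p < i + m} =
        Set.Icc (uPar i m ρ + (Cmid1 i m ρ).ncard) (vPar i m ρ - (Cmid3 i m ρ).ncard) ∧
      pv β '' {p | i + m ≤ p ∧ p < n + m - 1} =
        {x ∈ pv ρ '' {p | i + m ≤ p ∧ p < n + m - 1} | x < uPar i m ρ} ∪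
          Set.Ioc (vPar i m ρ - (Cmid3 i m ρ).ncard) (vPar i m ρ) ∪
          {x ∈ pv ρ '' {p | i + m ≤ p ∧ p < n + m - 1} | vPar i m ρ < x} ∧
      (∀ p q : Fin n, σ p < σ q ↔
        concatFun i m (uPar i m ρ + (Cmid1 i m ρ).ncard) β p <
          concatFun i m (uPar i m ρ + (Cmid1 i m ρ).ncard) β q) ∧
      (∀ p q : Fin m, τ p < τ q ↔ pv ρ (i + p) < pv ρ (i + q))

/-- Order-isomorphic functions whose images agree below `u` coincide at the points where
the first one takes a value below `u`. -/
lemma eq_of_image_agree_below {ι α : Type*} [LinearOrder α] {S : Set ι} (hS : S.Finite)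
    {f g : ι → α} (hfg : ∀ p ∈ S, ∀ q ∈ S, (g p < g q ↔ f p < f q)) {u : α}
    (hu : ∀ x < u, (x ∈ g '' S ↔ x ∈ f '' S)) {p : ι} (hp : p ∈ S) (hpu : f p < u) :
    g p = f p := by
  have heq : ∀ p ∈ S, ∀ q ∈ S, f p = f q → g p = g q := fun p hp q hq hpq =>
    le_antisymm (not_lt.1 fun h => ((hfg q hq p hp).1 h).ne' hpq)
      (not_lt.1 fun h => ((hfg p hp q hq).1 h).ne hpq)
  by_contra hne
  obtain ⟨a, ⟨haS, hau, han⟩, hmin⟩ :=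
    Set.exists_min_image {p ∈ S | f p < u ∧ g p ≠ f p} f (hS.subset fun x hx => hx.1)
      ⟨p, hp, hpu, hne⟩
  have hlt : ∀ q ∈ S, f q < f a → g q = f q := fun q hq hqa => by
    by_contra hqn
    exact (hmin q ⟨hq, hqa.trans hau, hqn⟩).not_gt hqa
  obtain ⟨q, hq, hqa⟩ := (hu _ hau).2 ⟨a, haS, rfl⟩
  rcases lt_trichotomy (f q) (f a) with h | h | h
  · exact h.ne ((hlt q hq h).symm.trans hqa)
  · exact han ((heq q hq a haS h).symm.trans hqa)
  · have hga : g a < f a := hqa ▸ (hfg a haS q hq).2 h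
    obtain ⟨r, hr, hra⟩ := (hu _ (hga.trans hau)).1 ⟨a, haS, rfl⟩
    have hrlt : f r < f a := hra ▸ hga
    exact ((hfg r hr a haS).2 hrlt).ne ((hlt r hr hrlt).trans hra)

/-- If `g` orders the block `S` as `f` does and its image is obtained from that of `f` by
replacing the values between `u` and `v` by the set `M`, then `g` agrees with `f` outside
`[u, v]` and takes values in `M` where `f` lies between `u` and `v`. -/
lemma block_trichotomy {ι : Type*} {S : Set ι} (hS : S.Finite)
    {f g : ι → ℕ} (hfg : ∀ p ∈ S, ∀ q ∈ S, (g p < g q ↔ f p < f q)) {u v : ℕ}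
    {M : Set ℕ} (hM : M ⊆ Set.Icc u v) (hfu : ∀ p ∈ S, f p ≠ u) (hfv : ∀ p ∈ S, f p ≠ v)
    (himg : g '' S = {x ∈ f '' S | x < u} ∪ M ∪ {x ∈ f '' S | v < x})
    {p : ι} (hp : p ∈ S) :
    (f p < u ∧ g p = f p) ∨ (u < f p ∧ f p < v ∧ g p ∈ M) ∨ (v < f p ∧ g p = f p) := by
  have hlow : ∀ x < u, (x ∈ g '' S ↔ x ∈ f '' S) := fun x hx => by
    rw [himg]
    constructor
    · rintro ((h | h) | h)
      · exact h.1
      · exact absurd (hM h).1 hx.not_ge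
      · exact h.1
    · exact fun h => Or.inl (Or.inl ⟨h, hx⟩)
  have hhigh : ∀ x > v, (x ∈ g '' S ↔ x ∈ f '' S) := fun x hx => by
    rw [himg]
    constructor
    · rintro ((h | h) | h)
      · exact h.1
      · exact absurd (hM h).2 hx.not_ge
      · exact h.1
    · exact fun h => Or.inr ⟨h, hx⟩
  have hgf : ∀ p ∈ S, ∀ q ∈ S, (f p < f q ↔ g p < g q) := fun p hp q hq => (hfg p hp q hq).symm
  rcases lt_or_gt_of_ne (hfu p hp) with h | hu
  · exact Or.inl ⟨h, eq_of_image_agree_below hS hfg hlow hp h⟩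
  rcases lt_or_gt_of_ne (hfv p hp) with hv | h
  · refine Or.inr (Or.inl ⟨hu, hv, ?_⟩)
    have hgp : g p ∈ g '' S := ⟨p, hp, rfl⟩
    rw [himg] at hgp
    rcases hgp with (h | h) | h
    · have := eq_of_image_agree_below hS hgf (fun x hx => (hlow x hx).symm) hp h.2
      have := h.2
      omega
    · exact h
    · have := eq_of_image_agree_below (α := ℕᵒᵈ) hS (fun p hp q hq => hgf q hq p hp)
        (fun x hx => (hhigh x hx).symm) hp h.2
      have h2 := h.2
      rw [← this] at h2
      exact absurd h2 hv.not_gt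
  · exact Or.inr (Or.inr ⟨h, eq_of_image_agree_below (α := ℕᵒᵈ) hS
      (fun p hp q hq => hfg q hq p hp) hhigh hp h⟩)

lemma pv_coe {N : ℕ} (σ : Equiv.Perm (Fin N)) (p : Fin N) : pv σ p = σ p := by
  simp [pv]

lemma pv_ne {N : ℕ} (σ : Equiv.Perm (Fin N)) {p q : ℕ} (hp : p < N) (hq : q < N) (h : p ≠ q) :
    pv σ p ≠ pv σ q := by
  simpa [pv, hp, hq, Fin.val_inj] using h

lemma wle_iff_pv {N : ℕ} {σ τ : Equiv.Perm (Fin N)} :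
    wle σ τ ↔ ∀ p q : ℕ, p < q → q < N → pv σ q < pv σ p → pv τ q < pv τ p := by
  constructor
  · intro h p q hpq hq hlt
    have := h ⟨p, hpq.trans hq⟩ ⟨q, hq⟩ hpq
    simp only [pv, hpq.trans hq, hq, dif_pos] at hlt ⊢
    exact this hlt
  · intro h p q hpq hlt
    have := h p q hpq q.2
    simp only [pv_coe] at this
    exact this hlt

section Block

variable {N : ℕ} (i m : ℕ) (ρ : Equiv.Perm (Fin N))

lemma finite_block : (pv ρ '' {p | i ≤ p ∧ p < i + m}).Finite :=
  (Set.finite_Ico i (i + m)).image _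

lemma uPar_le {x : ℕ} (h1 : i ≤ x) (h2 : x < i + m) : uPar i m ρ ≤ pv ρ x :=
  Nat.sInf_le ⟨x, ⟨h1, h2⟩, rfl⟩

lemma le_vPar {x : ℕ} (h1 : i ≤ x) (h2 : x < i + m) : pv ρ x ≤ vPar i m ρ :=
  le_csSup (finite_block i m ρ).bddAbove ⟨x, ⟨h1, h2⟩, rfl⟩

lemma exists_uPar (hm : 1 ≤ m) : ∃ x, i ≤ x ∧ x < i + m ∧ pv ρ x = uPar i m ρ := by
  have hne : (pv ρ '' {p | i ≤ p ∧ p < i + m}).Nonempty := ⟨_, i, ⟨le_rfl, by omega⟩, rfl⟩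
  obtain ⟨x, hx, h⟩ := Nat.sInf_mem hne
  exact ⟨x, hx.1, hx.2, h⟩

lemma exists_vPar (hm : 1 ≤ m) : ∃ x, i ≤ x ∧ x < i + m ∧ pv ρ x = vPar i m ρ := by
  have hne : (pv ρ '' {p | i ≤ p ∧ p < i + m}).Nonempty := ⟨_, i, ⟨le_rfl, by omega⟩, rfl⟩
  obtain ⟨x, hx, h⟩ := Nat.sSup_mem hne (finite_block i m ρ).bddAbove
  exact ⟨x, hx.1, hx.2, h⟩

end Block

/-- The inversions of the first component of `P_i(ρ)`, expressed in terms of those of `ρ`. -/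
def InvFst {N : ℕ} (i m : ℕ) (ρ : Equiv.Perm (Fin N)) (p q : ℕ) : Prop :=
  if q < i then pv ρ q < pv ρ p
  else if i < p then pv ρ (q + m - 1) < pv ρ (p + m - 1)
  else if q = i then ∀ x, i ≤ x → x < i + m → pv ρ x < pv ρ p
  else if p = i then ∀ x, i ≤ x → x < i + m → pv ρ (q + m - 1) < pv ρ x
  else pv ρ (q + m - 1) < pv ρ p ∧
    ((∀ x, i ≤ x → x < i + m → pv ρ x < pv ρ p) ∨
      ∀ x, i ≤ x → x < i + m → pv ρ (q + m - 1) < pv ρ x)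

lemma InvFst.mono {n m i : ℕ} (hi : i < n) (hm : 1 ≤ m) {ρ ρ' : Equiv.Perm (Fin (n + m - 1))}
    (h : wle ρ ρ') {p q : ℕ} (hpq : p < q) (hq : q < n) (hinv : InvFst i m ρ p q) :
    InvFst i m ρ' p q := by
  rw [wle_iff_pv] at h
  unfold InvFst at hinv ⊢
  have h1 : p < i → (∀ x, i ≤ x → x < i + m → pv ρ x < pv ρ p) →
      ∀ x, i ≤ x → x < i + m → pv ρ' x < pv ρ' p := fun hp H x hx hx' =>
    h p x (by omega) (by omega) (H x hx hx')
  have h2 : i < q → (∀ x, i ≤ x → x < i + m → pv ρ (q + m - 1) < pv ρ x) →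
      ∀ x, i ≤ x → x < i + m → pv ρ' (q + m - 1) < pv ρ' x := fun hq' H x hx hx' =>
    h x (q + m - 1) (by omega) (by omega) (H x hx hx')
  split_ifs at hinv ⊢
  · exact h _ _ hpq (by omega) hinv
  · exact h _ _ (by omega) (by omega) hinv
  · exact h1 (by omega) hinv
  · exact h2 (by omega) hinv
  · exact ⟨h _ _ (by omega) (by omega) hinv.1,
      hinv.2.imp (h1 (by omega)) (h2 (by omega))⟩

lemma IsP.fst_lt_iff {n m i : ℕ} (hi : i < n) (hm : 1 ≤ m) (hm1 : m ≠ 1)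
    {ρ : Equiv.Perm (Fin (n + m - 1))} {σ : Equiv.Perm (Fin n)} {τ : Equiv.Perm (Fin m)}
    (hP : IsP i ρ σ τ) {p q : Fin n} (hpq : p < q) :
    σ q < σ p ↔ InvFst i m ρ p q := by
  rw [IsP, if_neg hm1] at hP
  obtain ⟨β, ho1, -, ho3, hi1, hi2, hi3, hσ, -⟩ := hP
  rw [hσ]
  have hpq' : (p : ℕ) < q := hpq
  have hq := q.2
  obtain ⟨a, ha, ha', hau⟩ := exists_uPar i m ρ hm
  obtain ⟨b, hb, hb', hbv⟩ := exists_vPar i m ρ hm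
  have hmin := fun x hx hx' => uPar_le i m ρ (x := x) hx hx'
  have hmax := fun x hx hx' => le_vPar i m ρ (x := x) hx hx'
  generalize uPar i m ρ = u at *
  generalize vPar i m ρ = v at *
  generalize (Cmid1 i m ρ).ncard = c at *
  generalize (Cmid3 i m ρ).ncard = d at *
  have hcd : u + c ≤ v - d := by
    have : pv β i ∈ pv β '' {p | i ≤ p ∧ p < i + m} := ⟨i, ⟨le_rfl, by omega⟩, rfl⟩
    rw [hi2] at this
    exact this.1.trans this.2
  have hL1 : ∀ p < i, (pv ρ p < u ∧ pv β p = pv ρ p) ∨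
      (u < pv ρ p ∧ pv ρ p < v ∧ pv β p ∈ Set.Ico u (u + c)) ∨
      (v < pv ρ p ∧ pv β p = pv ρ p) := fun p hp =>
    block_trichotomy (S := {p | p < i}) (Set.finite_Iio i) (fun p hp q hq => ho1 p q hp hq)
      (fun x hx => ⟨hx.1, by have := hx.2; omega⟩)
      (fun p (hp : p < i) => hau ▸ pv_ne ρ (by omega) (by omega) (by omega))
      (fun p (hp : p < i) => hbv ▸ pv_ne ρ (by omega) (by omega) (by omega)) hi1 hp
  have hL3 : ∀ p, i + m ≤ p → p < n + m - 1 → (pv ρ p < u ∧ pv β p = pv ρ p) ∨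
      (u < pv ρ p ∧ pv ρ p < v ∧ pv β p ∈ Set.Ioc (v - d) v) ∨
      (v < pv ρ p ∧ pv β p = pv ρ p) := fun p hp hp' =>
    block_trichotomy (S := {p | i + m ≤ p ∧ p < n + m - 1}) (Set.finite_Ico (i + m) (n + m - 1))
      (fun p hp q hq => ho3 p q hp.1 hp.2 hq.1 hq.2)
      (fun x hx => ⟨by have := hx.1; omega, hx.2⟩)
      (fun p hp => by
        obtain ⟨h1, h2⟩ := hp
        exact hau ▸ pv_ne ρ h2 (by omega) (by omega))
      (fun p hp => by
        obtain ⟨h1, h2⟩ := hp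
        exact hbv ▸ pv_ne ρ h2 (by omega) (by omega)) hi3 ⟨hp, hp'⟩
  have hall1 : ∀ y, (∀ x, i ≤ x → x < i + m → pv ρ x < y) ↔ v < y := fun y =>
    ⟨fun H => hbv ▸ H b hb hb', fun H x hx hx' => (hmax x hx hx').trans_lt H⟩
  have hall3 : ∀ y, (∀ x, i ≤ x → x < i + m → y < pv ρ x) ↔ y < u := fun y =>
    ⟨fun H => hau ▸ H a ha ha', fun H x hx hx' => H.trans_le (hmin x hx hx')⟩
  simp only [Set.mem_Ico, Set.mem_Ioc] at hL1 hL3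
  simp only [InvFst, hall1, hall3, concatFun]
  rcases lt_trichotomy (q : ℕ) i with hqi | hqi | hqi
  · rw [if_pos hqi, if_pos (hpq'.trans hqi), if_pos hqi]
    exact ho1 _ _ hqi (hpq'.trans hqi)
  · have := hL1 p (by omega)
    simp only [hqi, lt_irrefl, if_true, if_false, hqi ▸ hpq', not_lt_of_gt (hqi ▸ hpq')]
    omega
  · have h3 := hL3 (q + m - 1) (by omega) (by omega)
    rw [if_neg hqi.not_gt, if_neg hqi.ne', if_neg hqi.not_gt]
    rcases lt_trichotomy (p : ℕ) i with hpi | hpi | hpi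
    · have := hL1 p hpi
      rw [if_pos hpi, if_neg hpi.not_gt, if_neg hqi.ne', if_neg hpi.ne]
      omega
    · simp only [hpi, lt_irrefl, if_true, if_false, hqi.ne']
      omega
    · rw [if_neg hpi.not_gt, if_neg hpi.ne', if_pos hpi]
      exact ho3 _ _ (by omega) (by omega) (by omega) (by omega)

lemma IsP.snd_lt_iff {n m i : ℕ} (hm1 : m ≠ 1)
    {ρ : Equiv.Perm (Fin (n + m - 1))} {σ : Equiv.Perm (Fin n)} {τ : Equiv.Perm (Fin m)}
    (hP : IsP i ρ σ τ) (p q : Fin m) :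
    τ p < τ q ↔ pv ρ (i + p) < pv ρ (i + q) := by
  rw [IsP, if_neg hm1] at hP
  obtain ⟨-, -, -, -, -, -, -, -, hτ⟩ := hP
  exact hτ p q

/-- **Theorem.** The map `P_i : S_{n+m-1} → S_n × S_m` is order-preserving: if `ρ ≤ ρ'`
in the left weak order, then `P_i(ρ) ≤ P_i(ρ')` in the product of the weak orders. -/
theorem P_orderPreserving {n m : ℕ} (hn : 1 ≤ n) (hm : 1 ≤ m) (i : ℕ) (hi : i < n)
    (ρ ρ' : Equiv.Perm (Fin (n + m - 1)))
    (σ σ' : Equiv.Perm (Fin n)) (τ τ' : Equiv.Perm (Fin m))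
    (hP : IsP i ρ σ τ) (hP' : IsP i ρ' σ' τ') (h : wle ρ ρ') :
    wle σ σ' ∧ wle τ τ' := by
  by_cases hm1 : m = 1
  · rw [IsP, if_pos hm1] at hP hP'
    refine ⟨?_, by rw [hP.2, hP'.2]; exact fun p q _ hlt => hlt⟩
    rw [wle_iff_pv] at h ⊢
    intro p q hpq hq
    rw [hP.1, hP.1, hP'.1, hP'.1]
    exact h p q hpq (by omega)
  · refine ⟨fun p q hpq hlt => ?_, fun p q hpq hlt => ?_⟩
    · rw [hP.fst_lt_iff hi hm hm1 hpq] at hlt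
      rw [hP'.fst_lt_iff hi hm hm1 hpq]
      exact hlt.mono hi hm h hpq q.2
    · rw [hP.snd_lt_iff hm1] at hlt
      rw [hP'.snd_lt_iff hm1]
      have hpq' : (p : ℕ) < q := hpq
      exact wle_iff_pv.1 h _ _ (by omega) (by omega) hlt
end
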